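/- (Uniform exponential stability of the homogeneous system.) Assume (A0). Then there exist constants C ≥ 1 and γ > 0, depending only on the matrices M1, M2, D, G, N, such that for every differentiable x1 : [0,∞) → ℝ^{k1}, differentiable x2 : [0,∞) → ℝ^{k2} and arbitrary x3 : [0,∞) → ℝ^{k3} satisfying for all t ≥ 0: M1·x1'(t) + G·x2(t) = 0, M2·x2'(t) − Gᵀ·x1(t) + D·x2(t) − Nᵀ·x3(t) = 0 and N·x2(t) = 0, the energy E_h(t) = (1/2)·(⟨x1(t), M1·x1(t)⟩ + ⟨x2(t), M2·x2(t)⟩) satisfies E_h(t) ≤ C·exp(−γ·(t − s))·E_h(s) for all t ≥ s ≥ 0. -/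

import Mathlib

open Matrix

theorem exists_mulVec_dotProduct_self_le {m n : ℕ} (A : Matrix (Fin m) (Fin n) ℝ) :
    ∃ c : ℝ, ∀ y, A *ᵥ y ⬝ᵥ A *ᵥ y ≤ c * (y ⬝ᵥ y) := by
  refine ⟨∑ i, ∑ j, A i j ^ 2, fun y => ?_⟩
  simp only [dotProduct, mulVec, ← pow_two, Finset.sum_mul]
  refine Finset.sum_le_sum fun i _ => ?_
  rw [← Finset.sum_mul]
  exact Finset.sum_mul_sq_le_sq_mul_sq _ _ _

open scoped MatrixOrder Matrix.Norms.L2Operator in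
theorem Matrix.PosDef.exists_mul_dotProduct_self_le {n : ℕ} {A : Matrix (Fin n) (Fin n) ℝ}
    (hA : A.PosDef) : ∃ c : ℝ, 0 < c ∧ ∀ y, c * (y ⬝ᵥ y) ≤ y ⬝ᵥ A *ᵥ y := by
  obtain ⟨B, hB⟩ := CStarAlgebra.nonneg_iff_eq_star_mul_self.mp hA.posSemidef.nonneg
  rw [star_eq_conjTranspose] at hB
  obtain ⟨c, hc⟩ := exists_mulVec_dotProduct_self_le (A⁻¹ * Bᴴ)
  have hdet : IsUnit A.det := hA.det_pos.ne'.isUnit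
  have hc' : ∀ y, y ⬝ᵥ y ≤ c * (y ⬝ᵥ A *ᵥ y) := fun y => by
    have h := hc (B *ᵥ y)
    have h₁ : B *ᵥ y ⬝ᵥ B *ᵥ y = y ⬝ᵥ A *ᵥ y := by
      rw [hB, ← mulVec_mulVec, dotProduct_mulVec y, conjTranspose_eq_transpose_of_trivial,
        vecMul_transpose]
    rwa [mulVec_mulVec, Matrix.mul_assoc, ← hB, nonsing_inv_mul A hdet, one_mulVec, h₁] at h
  have hpos : (0 : ℝ) < |c| + 1 := by positivity
  refine ⟨(|c| + 1)⁻¹, inv_pos.mpr hpos, fun y => ?_⟩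
  rw [inv_mul_le_iff₀ hpos]
  have h₀ : 0 ≤ y ⬝ᵥ A *ᵥ y := by simpa using hA.posSemidef.dotProduct_mulVec_nonneg y
  exact (hc' y).trans (mul_le_mul_of_nonneg_right (by linarith [le_abs_self c]) h₀)

theorem abs_dotProduct_le {n : ℕ} (x y : Fin n → ℝ) :
    |x ⬝ᵥ y| ≤ (x ⬝ᵥ x + y ⬝ᵥ y) / 2 := by
  have h₁ : 0 ≤ (x - y) ⬝ᵥ (x - y) := Finset.sum_nonneg fun i _ => mul_self_nonneg _
  have h₂ : 0 ≤ (x + y) ⬝ᵥ (x + y) := Finset.sum_nonneg fun i _ => mul_self_nonneg _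
  simp only [sub_dotProduct, dotProduct_sub, add_dotProduct, dotProduct_add,
    dotProduct_comm y x] at h₁ h₂
  rw [abs_le]
  constructor <;> linarith

theorem HasDerivAt.dotProduct {n : ℕ} {x y : ℝ → Fin n → ℝ} {x' y' : Fin n → ℝ} {t : ℝ}
    (hx : HasDerivAt x x' t) (hy : HasDerivAt y y' t) :
    HasDerivAt (fun s => x s ⬝ᵥ y s) (x' ⬝ᵥ y t + x t ⬝ᵥ y') t := by
  simp only [_root_.dotProduct, ← Finset.sum_add_distrib]
  exact HasDerivAt.fun_sum fun i _ => (hasDerivAt_pi.mp hx i).mul (hasDerivAt_pi.mp hy i)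

theorem HasDerivAt.const_mulVec {m n : ℕ} (A : Matrix (Fin m) (Fin n) ℝ) {x : ℝ → Fin n → ℝ}
    {x' : Fin n → ℝ} {t : ℝ} (hx : HasDerivAt x x' t) :
    HasDerivAt (fun s => A *ᵥ x s) (A *ᵥ x') t :=
  A.mulVecLin.toContinuousLinearMap.hasFDerivAt.comp_hasDerivAt t hx

theorem exists_mulVec_leftInverse {k1 k2 k3 : ℕ} (G : Matrix (Fin k1) (Fin k2) ℝ)
    (N : Matrix (Fin k3) (Fin k2) ℝ)
    (hGN : Function.Injective fun x : (Fin k1 → ℝ) × (Fin k3 → ℝ) => Gᵀ *ᵥ x.1 + Nᵀ *ᵥ x.2) :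
    ∃ Q : Matrix (Fin k1) (Fin k2) ℝ, ∀ x y, Q *ᵥ (Gᵀ *ᵥ x + Nᵀ *ᵥ y) = x := by
  obtain ⟨g, hg⟩ := (Gᵀ.mulVecLin.coprod Nᵀ.mulVecLin).exists_leftInverse_of_injective
    (LinearMap.ker_eq_bot.mpr hGN)
  refine ⟨LinearMap.toMatrix' (LinearMap.fst ℝ _ _ ∘ₗ g), fun x y => ?_⟩
  rw [LinearMap.toMatrix'_mulVec]
  exact congrArg Prod.fst (LinearMap.congr_fun hg (x, y))

theorem le_exp_mul_of_hasDerivAt_le {H H' : ℝ → ℝ} {γ : ℝ}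
    (hH : ∀ t, 0 ≤ t → HasDerivAt H (H' t) t) (hle : ∀ t, 0 ≤ t → H' t ≤ -γ * H t)
    {s t : ℝ} (hs : 0 ≤ s) (hst : s ≤ t) : H t ≤ Real.exp (-γ * (t - s)) * H s := by
  have hd : ∀ t, 0 ≤ t → HasDerivAt (fun u => Real.exp (γ * u) * H u)
      (Real.exp (γ * t) * γ * H t + Real.exp (γ * t) * H' t) t := fun t ht => by
    simpa using (((hasDerivAt_id t).const_mul γ).exp).fun_mul (hH t ht)
  have hanti : AntitoneOn (fun u => Real.exp (γ * u) * H u) (Set.Ici 0) := by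
    refine antitoneOn_of_deriv_nonpos (convex_Ici 0)
      (fun u hu => (hd u hu).continuousAt.continuousWithinAt) ?_ ?_
    · exact fun u hu => (hd u (interior_subset hu)).differentiableAt.differentiableWithinAt
    · intro u hu
      have hu' : (0 : ℝ) ≤ u := interior_subset hu
      rw [(hd u hu').deriv]
      nlinarith [hle u hu', Real.exp_pos (γ * u)]
  have h := hanti (Set.mem_Ici.mpr hs) (Set.mem_Ici.mpr (hs.trans hst)) hst
  have hexp : Real.exp (-γ * (t - s)) = Real.exp (γ * s) / Real.exp (γ * t) := by
    rw [← Real.exp_sub]; ring_nf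
  rw [hexp, div_mul_eq_mul_div, le_div_iff₀ (Real.exp_pos _)]
  simpa only [mul_comm] using h

open Filter Topology in
theorem eventually_mul_le_of_pos (c : ℝ) {q : ℝ} (hq : 0 < q) :
    ∀ᶠ ε in 𝓝[>] (0 : ℝ), ε * c ≤ q := by
  have h : Tendsto (fun ε : ℝ => ε * c) (𝓝[>] 0) (𝓝 0) := by
    simpa using (tendsto_id.mul_const c).mono_left (nhdsWithin_le_nhds (a := (0 : ℝ)))
  exact h.eventually_le_const hq

/-- Uniform exponential stability of the homogeneous system: under (A0) there
are constants C ≥ 1 and γ > 0, depending only on the system matrices, such that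
every solution of the homogeneous differential-algebraic system satisfies
E_h(t) ≤ C·exp(−γ(t−s))·E_h(s) for all t ≥ s ≥ 0. -/
theorem uniform_exponential_stability {k1 k2 k3 : ℕ}
    (M1 : Matrix (Fin k1) (Fin k1) ℝ) (M2 D : Matrix (Fin k2) (Fin k2) ℝ)
    (G : Matrix (Fin k1) (Fin k2) ℝ) (N : Matrix (Fin k3) (Fin k2) ℝ)
    (hM1 : M1.PosDef) (hM2 : M2.PosDef) (hD : D.PosDef)
    (hGN : Function.Injective fun x : (Fin k1 → ℝ) × (Fin k3 → ℝ) =>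
      Gᵀ.mulVec x.1 + Nᵀ.mulVec x.2) :
    ∃ C : ℝ, 1 ≤ C ∧ ∃ γ : ℝ, 0 < γ ∧
      ∀ (x1 : ℝ → Fin k1 → ℝ) (x2 : ℝ → Fin k2 → ℝ) (x3 : ℝ → Fin k3 → ℝ)
        (x1' : ℝ → Fin k1 → ℝ) (x2' : ℝ → Fin k2 → ℝ),
        (∀ t, 0 ≤ t → HasDerivAt x1 (x1' t) t) →
        (∀ t, 0 ≤ t → HasDerivAt x2 (x2' t) t) →
        (∀ t, 0 ≤ t → M1.mulVec (x1' t) + G.mulVec (x2 t) = 0) →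
        (∀ t, 0 ≤ t → M2.mulVec (x2' t) - Gᵀ.mulVec (x1 t) + D.mulVec (x2 t) -
          Nᵀ.mulVec (x3 t) = 0) →
        (∀ t, 0 ≤ t → N.mulVec (x2 t) = 0) →
        ∀ s t : ℝ, 0 ≤ s → s ≤ t →
          (1 / 2) * (x1 t ⬝ᵥ M1.mulVec (x1 t) + x2 t ⬝ᵥ M2.mulVec (x2 t)) ≤
            C * Real.exp (-γ * (t - s)) *
              ((1 / 2) * (x1 s ⬝ᵥ M1.mulVec (x1 s) + x2 s ⬝ᵥ M2.mulVec (x2 s))) := by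
  obtain ⟨Q, hQ⟩ := exists_mulVec_leftInverse G N hGN
  obtain ⟨m₁, hm₁, hM1_lower⟩ := hM1.exists_mul_dotProduct_self_le
  obtain ⟨m₂, hm₂, hM2_lower⟩ := hM2.exists_mul_dotProduct_self_le
  obtain ⟨d, hd, hD_lower⟩ := hD.exists_mul_dotProduct_self_le
  obtain ⟨c₁, hc₁⟩ := exists_mulVec_dotProduct_self_le M1
  obtain ⟨c₂, hc₂⟩ := exists_mulVec_dotProduct_self_le M2
  obtain ⟨cK, hcK⟩ := exists_mulVec_dotProduct_self_le (Q * M2)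
  obtain ⟨cP, hcP⟩ := exists_mulVec_dotProduct_self_le (Q * D)
  obtain ⟨cR, hcR⟩ := exists_mulVec_dotProduct_self_le (M1⁻¹ * G)
  obtain ⟨ε, ⟨⟨hε₁, hε₂⟩, hε₃⟩, hε⟩ := (((eventually_mul_le_of_pos 2 hm₁).and
    (eventually_mul_le_of_pos (2 * cK) hm₂)).and
    (eventually_mul_le_of_pos (cP + cR + cK) hd)).and self_mem_nhdsWithin |>.exists
  replace hε : 0 < ε := hε
  obtain ⟨γ, ⟨hγ₁, hγ₂⟩, hγ⟩ := ((eventually_mul_le_of_pos (1 + c₁) hε).and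
    (eventually_mul_le_of_pos (1 + c₂) hd)).and self_mem_nhdsWithin |>.exists
  replace hγ : 0 < γ := hγ
  refine ⟨4, by norm_num, γ, hγ, ?_⟩
  intro x1 x2 x3 x1' x2' hx1 hx2 h1 h2 h3 s t hs hst
  set E : ℝ → ℝ := fun t => (1 / 2) * (x1 t ⬝ᵥ M1 *ᵥ x1 t + x2 t ⬝ᵥ M2 *ᵥ x2 t) with hE
  set H : ℝ → ℝ := fun t => E t - ε * (x1 t ⬝ᵥ (Q * M2) *ᵥ x2 t) with hH
  have hnn : ∀ {n : ℕ} (x : Fin n → ℝ), 0 ≤ x ⬝ᵥ x := fun x =>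
    Finset.sum_nonneg fun i _ => mul_self_nonneg _
  have hsymm : ∀ {n : ℕ} {A : Matrix (Fin n) (Fin n) ℝ}, A.PosDef →
      ∀ x y, x ⬝ᵥ A *ᵥ y = y ⬝ᵥ A *ᵥ x := fun {n A} hA x y => by
    have hT : Aᵀ = A := by simpa using hA.isHermitian.eq
    rw [dotProduct_mulVec, ← mulVec_transpose, hT, dotProduct_comm]
  have hcross : ∀ t, |ε * (x1 t ⬝ᵥ (Q * M2) *ᵥ x2 t)| ≤ E t / 2 := fun t => by
    have h := abs_dotProduct_le (x1 t) ((Q * M2) *ᵥ x2 t)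
    rw [abs_mul, abs_of_pos hε]
    have h' := mul_le_mul_of_nonneg_left (h.trans (by linarith [hcK (x2 t)] :
      _ ≤ (x1 t ⬝ᵥ x1 t + cK * (x2 t ⬝ᵥ x2 t)) / 2)) hε.le
    have i₁ := mul_le_mul_of_nonneg_right hε₁ (hnn (x1 t))
    have i₂ := mul_le_mul_of_nonneg_right hε₂ (hnn (x2 t))
    simp only [hE]
    linarith [hM1_lower (x1 t), hM2_lower (x2 t)]
  have hHderiv : ∀ t, 0 ≤ t → HasDerivAt H (-(x2 t ⬝ᵥ D *ᵥ x2 t) - ε * (x1 t ⬝ᵥ x1 t) +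
      ε * (x1 t ⬝ᵥ (Q * D) *ᵥ x2 t) +
      ε * ((M1⁻¹ * G) *ᵥ x2 t ⬝ᵥ (Q * M2) *ᵥ x2 t)) t := fun t ht => by
    have e₁ : M1 *ᵥ x1' t = -(G *ᵥ x2 t) := eq_neg_of_add_eq_zero_left (h1 t ht)
    have e₂ : M2 *ᵥ x2' t = Gᵀ *ᵥ x1 t + Nᵀ *ᵥ x3 t - D *ᵥ x2 t := by
      rw [← sub_eq_zero, ← h2 t ht]; abel
    have e₃ : (Q * M2) *ᵥ x2' t = x1 t - (Q * D) *ᵥ x2 t := by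
      rw [← mulVec_mulVec, e₂, mulVec_sub, hQ, mulVec_mulVec]
    have e₄ : x1' t = -((M1⁻¹ * G) *ᵥ x2 t) := by
      rw [← mulVec_mulVec, ← mulVec_neg, ← e₁, mulVec_mulVec,
        nonsing_inv_mul M1 hM1.det_pos.ne'.isUnit, one_mulVec]
    have hG : x2 t ⬝ᵥ Gᵀ *ᵥ x1 t = x1 t ⬝ᵥ G *ᵥ x2 t := by
      rw [dotProduct_mulVec, vecMul_transpose, dotProduct_comm]
    have hN : x2 t ⬝ᵥ Nᵀ *ᵥ x3 t = 0 := by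
      rw [dotProduct_mulVec, vecMul_transpose, h3 t ht, zero_dotProduct]
    have hder := ((((hx1 t ht).dotProduct ((hx1 t ht).const_mulVec M1)).add
      ((hx2 t ht).dotProduct ((hx2 t ht).const_mulVec M2))).const_mul (1 / 2)).sub
      (((hx1 t ht).dotProduct ((hx2 t ht).const_mulVec (Q * M2))).const_mul ε)
    refine hder.congr_deriv ?_
    rw [hsymm hM1 (x1' t), hsymm hM2 (x2' t), e₁, e₂, e₃, e₄]
    simp only [dotProduct_neg, neg_dotProduct, dotProduct_add, dotProduct_sub, hG, hN]
    ring
  have hHle : ∀ t, 0 ≤ t → -(x2 t ⬝ᵥ D *ᵥ x2 t) - ε * (x1 t ⬝ᵥ x1 t) +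
      ε * (x1 t ⬝ᵥ (Q * D) *ᵥ x2 t) +
      ε * ((M1⁻¹ * G) *ᵥ x2 t ⬝ᵥ (Q * M2) *ᵥ x2 t) ≤ -γ * H t := fun t _ => by
    have b₁ := mul_le_mul_of_nonneg_left
      ((le_abs_self _).trans (abs_dotProduct_le (x1 t) ((Q * D) *ᵥ x2 t))) hε.le
    have b₂ := mul_le_mul_of_nonneg_left ((le_abs_self _).trans
      (abs_dotProduct_le ((M1⁻¹ * G) *ᵥ x2 t) ((Q * M2) *ᵥ x2 t))) hε.le
    have b₃ := mul_le_mul_of_nonneg_left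
      (add_le_add (add_le_add (hcP (x2 t)) (hcR (x2 t))) (hcK (x2 t))) hε.le
    have b₄ := mul_le_mul_of_nonneg_right hε₃ (hnn (x2 t))
    have b₅ := (le_abs_self _).trans (abs_dotProduct_le (x1 t) (M1 *ᵥ x1 t))
    have b₆ := (le_abs_self _).trans (abs_dotProduct_le (x2 t) (M2 *ᵥ x2 t))
    have hHE : H t ≤ ((1 + c₁) * (x1 t ⬝ᵥ x1 t) + (1 + c₂) * (x2 t ⬝ᵥ x2 t)) / 2 := by
      have := (abs_le.mp (hcross t)).1
      simp only [hH, hE] at this ⊢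
      linarith [hc₁ (x1 t), hc₂ (x2 t), hM1_lower (x1 t), hM2_lower (x2 t),
        mul_nonneg hm₁.le (hnn (x1 t)), mul_nonneg hm₂.le (hnn (x2 t))]
    have b₇ := mul_le_mul_of_nonneg_left hHE hγ.le
    have b₈ := mul_le_mul_of_nonneg_right hγ₁ (hnn (x1 t))
    have b₉ := mul_le_mul_of_nonneg_right hγ₂ (hnn (x2 t))
    linarith [hD_lower (x2 t)]
  have hdecay := le_exp_mul_of_hasDerivAt_le hHderiv hHle hs hst
  have ht' := (abs_le.mp (hcross t)).2
  have hs' := (abs_le.mp (hcross s)).1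
  have hmono := mul_le_mul_of_nonneg_left (by simp only [hH]; linarith : H s ≤ 3 / 2 * E s)
    (Real.exp_pos (-γ * (t - s))).le
  have hEs : 0 ≤ Real.exp (-γ * (t - s)) * E s :=
    mul_nonneg (Real.exp_pos _).le
      (by linarith [(abs_nonneg _).trans (hcross s)])
  change E t ≤ 4 * Real.exp (-γ * (t - s)) * E s
  have hHt : E t / 2 ≤ H t := by simp only [hH]; linarith
  linarith
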